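/- Let a = (a_1, a_2, ...) be a sequence of nonzero complex numbers such that a_i = c^i a for i = 1, 2, 3, where c ≠ 0 and a ≠ ±1. If Λ_a is Cohen–Macaulay (equivalently, a free module over C[Q_1,Q_2]), then a_i = c^i a for all i ≥ 1. -/

import Mathlib

open MvPolynomial

set_option synthInstance.maxHeartbeats 1000000
set_option maxHeartbeats 1000000

noncomputable section

/-- The polynomial ring `ℂ[y,z]`, with `y = X 0`, `z = X 1`. -/
abbrev R2 := MvPolynomial (Fin 2) ℂ

/-- The generalized power sum `Q_i = a_i y^i + z^i`. -/
def Q2 (a : ℕ → ℂ) (i : ℕ) : R2 := C (a i) * X 0 ^ i + X 1 ^ i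

/-- The algebra `Λ_a` generated by the `Q_i`, `i ≥ 1`. -/
def Lam (a : ℕ → ℂ) : Subalgebra ℂ R2 :=
  Algebra.adjoin ℂ {f : R2 | ∃ i : ℕ, 1 ≤ i ∧ f = Q2 a i}

/-- The subalgebra `ℂ[Q_1, Q_2]`. -/
def Bsub (a : ℕ → ℂ) : Subalgebra ℂ R2 :=
  Algebra.adjoin ℂ {Q2 a 1, Q2 a 2}

/-- `Λ_a`, viewed as a module over `ℂ[Q_1,Q_2]` (as the `ℂ[Q_1,Q_2]`-span of `Λ_a` in
`ℂ[y,z]`, which coincides with `Λ_a` since `Q_1, Q_2 ∈ Λ_a`). -/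
def LamMod (a : ℕ → ℂ) : Submodule ↥(Bsub a) R2 :=
  Submodule.span (Bsub a) (Lam a : Set R2)

/-- The degree-`n` homogeneous component of a graded subspace of `ℂ[y,z]`. -/
def comp2 (M : Submodule ℂ R2) (n : ℕ) : Submodule ℂ R2 :=
  M ⊓ homogeneousSubmodule (Fin 2) ℂ n

/-- The Hilbert series of a graded subspace of `ℂ[y,z]`, as a power series over `ℚ`. -/
def hilb2 (M : Submodule ℂ R2) : PowerSeries ℚ :=
  PowerSeries.mk fun n => (Module.finrank ℂ (comp2 M n) : ℚ)


/-- The linear form `c y - z`, which is anti-invariant under the involution of `ℂ[y,z]`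
over `ℂ[Q_1,Q_2]`. -/
def antiForm (c : ℂ) : R2 := C c * X 0 - X 1

/-- The derivation `∂_y - c A ∂_z`, which kills `Q_1`. -/
def skewDeriv (c A : ℂ) : Derivation ℂ R2 R2 := pderiv 0 - (C (c * A) : R2) • pderiv 1

/-- Restriction to the line `c y = z`. -/
def lineRestrict (c : ℂ) : R2 →ₐ[ℂ] Polynomial ℂ :=
  aeval ![Polynomial.X, Polynomial.C c * Polynomial.X]

lemma Q2_mem_Lam (a : ℕ → ℂ) {i : ℕ} (hi : 1 ≤ i) : Q2 a i ∈ Lam a :=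
  Algebra.subset_adjoin ⟨i, hi, rfl⟩

lemma Q2_one_mem_Bsub (a : ℕ → ℂ) : Q2 a 1 ∈ Bsub a := Algebra.subset_adjoin (by simp)

lemma Q2_two_mem_Bsub (a : ℕ → ℂ) : Q2 a 2 ∈ Bsub a := Algebra.subset_adjoin (by simp)

lemma Bsub_le_Lam (a : ℕ → ℂ) : Bsub a ≤ Lam a := by
  refine Algebra.adjoin_le ?_
  rintro x (rfl | rfl)
  · exact Q2_mem_Lam a le_rfl
  · exact Q2_mem_Lam a one_le_two

lemma C_mem_subalgebra (S : Subalgebra ℂ R2) (r : ℂ) : (C r : R2) ∈ S := S.algebraMap_mem r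

lemma lineRestrict_antiForm (c : ℂ) : lineRestrict c (antiForm c) = 0 := by
  simp [lineRestrict, antiForm]

lemma skewDeriv_Q2 (a : ℕ → ℂ) (c A : ℂ) (i : ℕ) :
    skewDeriv c A (Q2 a i) =
      C (a i) * ((i : R2) * X 0 ^ (i - 1)) - C (c * A) * ((i : R2) * X 1 ^ (i - 1)) := by
  simp [skewDeriv, Q2, Derivation.leibniz, Derivation.leibniz_pow, pderiv_X]

lemma skewDeriv_antiForm (c A : ℂ) : skewDeriv c A (antiForm c) = C (c * (1 + A)) := by
  simp [skewDeriv, antiForm, Derivation.leibniz, pderiv_X]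
  ring

/-- Elements of `Λ_a` have linear part proportional to `Q_1`. -/
lemma constantCoeff_skewDeriv_of_mem_Lam {a : ℕ → ℂ} {c A : ℂ} (h1 : a 1 = c * A) {x : R2}
    (hx : x ∈ Lam a) : constantCoeff (skewDeriv c A x) = 0 := by
  induction hx using Algebra.adjoin_induction with
  | mem x hx =>
    obtain ⟨i, hi, rfl⟩ := hx
    rw [skewDeriv_Q2]
    rcases hi.eq_or_lt with rfl | hi
    · simp [h1]
    · have : i - 1 ≠ 0 := by omega
      simp [this]
  | algebraMap r => simp
  | add x y _ _ hx hy => simp [hx, hy]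
  | mul x y _ _ hx hy => simp [Derivation.leibniz, hx, hy]

lemma LamMod_subset_Lam {a : ℕ → ℂ} {x : R2} (hx : x ∈ LamMod a) : x ∈ Lam a := by
  induction hx using Submodule.span_induction with
  | mem x hx => exact hx
  | zero => exact zero_mem _
  | add x y _ _ hx hy => exact add_mem hx hy
  | smul b x _ hx => exact mul_mem (Bsub_le_Lam a b.2) hx

lemma antiForm_notMem_LamMod {a : ℕ → ℂ} {c A : ℂ} (h1 : a 1 = c * A) (hc : c ≠ 0)
    (hA : 1 + A ≠ 0) : antiForm c ∉ LamMod a := by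
  intro h
  have := constantCoeff_skewDeriv_of_mem_Lam h1 (LamMod_subset_Lam h)
  rw [skewDeriv_antiForm] at this
  simp [hc, hA] at this

section Structure

variable {a : ℕ → ℂ} {c A : ℂ}

lemma C_mul_antiForm_sq (h1 : a 1 = c * A) (h2 : a 2 = c ^ 2 * A) :
    C A * antiForm c ^ 2 = C (1 + A) * Q2 a 2 - Q2 a 1 ^ 2 := by
  simp only [antiForm, Q2, h1, h2, map_mul, map_add, map_pow, map_one]
  ring

lemma antiForm_sq_mem_Bsub (h1 : a 1 = c * A) (h2 : a 2 = c ^ 2 * A) (hA0 : A ≠ 0) :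
    antiForm c ^ 2 ∈ Bsub a := by
  have h : antiForm c ^ 2 = C A⁻¹ * (C (1 + A) * Q2 a 2 - Q2 a 1 ^ 2) := by
    rw [← C_mul_antiForm_sq h1 h2, ← mul_assoc, ← C_mul, inv_mul_cancel₀ hA0, C_1, one_mul]
  rw [h]
  exact mul_mem (C_mem_subalgebra _ _) (sub_mem
    (mul_mem (C_mem_subalgebra _ _) (Q2_two_mem_Bsub a)) (pow_mem (Q2_one_mem_Bsub a) 2))

lemma antiForm_cube_mem_Lam (h1 : a 1 = c * A) (h2 : a 2 = c ^ 2 * A) (h3 : a 3 = c ^ 3 * A)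
    (hA0 : A ≠ 0) (hA1 : A ≠ 1) (hA2 : 1 + A ≠ 0) : antiForm c ^ 3 ∈ Lam a := by
  have hk : A * (1 - A) * (1 + A) ≠ 0 :=
    mul_ne_zero (mul_ne_zero hA0 (sub_ne_zero.2 hA1.symm)) hA2
  have key : C (A * (1 - A) * (1 + A)) * antiForm c ^ 3 =
      C ((1 + A) ^ 3) * Q2 a 3 - C (1 + A) * Q2 a 1 ^ 3
        - C (3 * A * (1 + A)) * (Q2 a 1 * antiForm c ^ 2) := by
    have e3 : (C 3 : R2) = 3 := map_ofNat C 3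
    simp only [antiForm, Q2, h1, h3, map_mul, map_add, map_sub, map_pow, map_one, e3]
    ring
  have h : antiForm c ^ 3 = C (A * (1 - A) * (1 + A))⁻¹ * (C ((1 + A) ^ 3) * Q2 a 3
      - C (1 + A) * Q2 a 1 ^ 3 - C (3 * A * (1 + A)) * (Q2 a 1 * antiForm c ^ 2)) := by
    rw [← key, ← mul_assoc, ← C_mul, inv_mul_cancel₀ hk, C_1, one_mul]
  have hQ1 := Q2_mem_Lam a le_rfl
  rw [h]
  exact mul_mem (C_mem_subalgebra _ _) (sub_mem (sub_mem
    (mul_mem (C_mem_subalgebra _ _) (Q2_mem_Lam a (by norm_num)))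
    (mul_mem (C_mem_subalgebra _ _) (pow_mem hQ1 3)))
    (mul_mem (C_mem_subalgebra _ _)
      (mul_mem hQ1 (Bsub_le_Lam a (antiForm_sq_mem_Bsub h1 h2 hA0)))))

/-- `ℂ[y,z] = B + B (c y - z)` for `B = ℂ[Q_1,Q_2]`. -/
lemma exists_eq_add_mul_antiForm (h1 : a 1 = c * A) (h2 : a 2 = c ^ 2 * A) (hc : c ≠ 0)
    (hA0 : A ≠ 0) (hA2 : 1 + A ≠ 0) (x : R2) :
    ∃ u ∈ Bsub a, ∃ v ∈ Bsub a, x = u + v * antiForm c := by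
  induction x using MvPolynomial.induction_on with
  | C r => exact ⟨C r, C_mem_subalgebra _ r, 0, zero_mem _, by ring⟩
  | add p q hp hq =>
    obtain ⟨u, hu, v, hv, rfl⟩ := hp
    obtain ⟨u', hu', v', hv', rfl⟩ := hq
    exact ⟨u + u', add_mem hu hu', v + v', add_mem hv hv', by ring⟩
  | mul_X p i hp =>
    obtain ⟨u, hu, v, hv, rfl⟩ := hp
    have hX : ∃ u ∈ Bsub a, ∃ v ∈ Bsub a, (X i : R2) = u + v * antiForm c := by
      have hQ1 := Q2_one_mem_Bsub a
      fin_cases i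
      · refine ⟨C (c * (1 + A))⁻¹ * Q2 a 1, mul_mem (C_mem_subalgebra _ _) hQ1,
          C (c * (1 + A))⁻¹, C_mem_subalgebra _ _, ?_⟩
        have : Q2 a 1 + antiForm c = C (c * (1 + A)) * X 0 := by
          simp only [antiForm, Q2, h1, map_mul, map_add, map_one]
          ring
        rw [← mul_add, this, ← mul_assoc, ← C_mul, inv_mul_cancel₀ (mul_ne_zero hc hA2), C_1,
          one_mul]
        rfl
      · refine ⟨C (1 + A)⁻¹ * Q2 a 1, mul_mem (C_mem_subalgebra _ _) hQ1,
          C (1 + A)⁻¹ * C (-A), mul_mem (C_mem_subalgebra _ _) (C_mem_subalgebra _ _), ?_⟩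
        have : Q2 a 1 + C (-A) * antiForm c = C (1 + A) * X 1 := by
          simp only [antiForm, Q2, h1, map_mul, map_add, map_neg, map_one]
          ring
        rw [mul_assoc, ← mul_add, this, ← mul_assoc, ← C_mul, inv_mul_cancel₀ hA2, C_1, one_mul]
        rfl
    obtain ⟨u', hu', v', hv', hX⟩ := hX
    have hw := antiForm_sq_mem_Bsub h1 h2 hA0
    exact ⟨u * u' + v * v' * antiForm c ^ 2,
      add_mem (mul_mem hu hu') (mul_mem (mul_mem hv hv') hw), u * v' + v * u',
      add_mem (mul_mem hu hv') (mul_mem hv hu'), by rw [hX]; ring⟩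

/-- Every element of `ℂ[Q_1,Q_2]` is a polynomial in `Q_1` modulo `(c y - z)^2`. -/
lemma exists_eq_aeval_add_of_mem_Bsub (h1 : a 1 = c * A) (h2 : a 2 = c ^ 2 * A)
    (hA0 : A ≠ 0) (hA2 : 1 + A ≠ 0) {b : R2} (hb : b ∈ Bsub a) :
    ∃ p : Polynomial ℂ, ∃ b' ∈ Bsub a,
      b = Polynomial.aeval (Q2 a 1) p + antiForm c ^ 2 * b' := by
  have hp (p : Polynomial ℂ) : Polynomial.aeval (Q2 a 1) p ∈ Bsub a :=
    Algebra.adjoin_mono (by simp) (Polynomial.aeval_mem_adjoin_singleton ℂ (Q2 a 1))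
  have hw := antiForm_sq_mem_Bsub h1 h2 hA0
  induction hb using Algebra.adjoin_induction with
  | mem x hx =>
    rcases hx with rfl | rfl
    · exact ⟨Polynomial.X, 0, zero_mem _, by simp⟩
    · refine ⟨Polynomial.C (1 + A)⁻¹ * Polynomial.X ^ 2, C (1 + A)⁻¹ * C A,
        mul_mem (C_mem_subalgebra _ _) (C_mem_subalgebra _ _), ?_⟩
      have h : C (1 + A)⁻¹ * (C (1 + A) * Q2 a 2) = Q2 a 2 := by
        rw [← mul_assoc, ← C_mul, inv_mul_cancel₀ hA2, C_1, one_mul]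
      have hs := C_mul_antiForm_sq h1 h2
      rw [map_mul, map_pow, Polynomial.aeval_X, Polynomial.aeval_C, algebraMap_eq]
      linear_combination -h - C (1 + A)⁻¹ * hs
  | algebraMap r => exact ⟨Polynomial.C r, 0, zero_mem _, by simp⟩
  | add x y _ _ hx hy =>
    obtain ⟨p, b, hb, rfl⟩ := hx
    obtain ⟨q, d, hd, rfl⟩ := hy
    exact ⟨p + q, b + d, add_mem hb hd, by rw [map_add]; ring⟩
  | mul x y _ _ hx hy =>
    obtain ⟨p, b, hb, rfl⟩ := hx
    obtain ⟨q, d, hd, rfl⟩ := hy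
    refine ⟨p * q, Polynomial.aeval (Q2 a 1) p * d + b * Polynomial.aeval (Q2 a 1) q
      + antiForm c ^ 2 * (b * d), ?_, by rw [map_mul]; ring⟩
    exact add_mem (add_mem (mul_mem (hp p) hd) (mul_mem hb (hp q))) (mul_mem hw (mul_mem hb hd))

/-- An element of `ℂ[Q_1,Q_2]` vanishing on the line `c y = z` is divisible by `(c y - z)^2`
in `ℂ[Q_1,Q_2]`. -/
lemma exists_eq_antiForm_sq_mul (h1 : a 1 = c * A) (h2 : a 2 = c ^ 2 * A) (hc : c ≠ 0)
    (hA0 : A ≠ 0) (hA2 : 1 + A ≠ 0) {b : R2} (hb : b ∈ Bsub a) (h0 : lineRestrict c b = 0) :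
    ∃ b' ∈ Bsub a, b = antiForm c ^ 2 * b' := by
  obtain ⟨p, b', hb', rfl⟩ := exists_eq_aeval_add_of_mem_Bsub h1 h2 hA0 hA2 hb
  have hQ : lineRestrict c (Q2 a 1) = Polynomial.C (c * (1 + A)) * Polynomial.X := by
    simp [lineRestrict, Q2, h1]
    ring
  rw [map_add, map_mul, map_pow, lineRestrict_antiForm, ← Polynomial.aeval_algHom_apply, hQ] at h0
  have hcomp : p.comp (Polynomial.C (c * (1 + A)) * Polynomial.X) = 0 := by
    rw [Polynomial.comp_eq_aeval]
    simpa using h0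
  have hp : p = 0 := by
    rcases Polynomial.comp_eq_zero_iff.1 hcomp with h | ⟨-, h⟩
    · exact h
    · have := congrArg (Polynomial.coeff · 1) h
      simp [hc, hA2] at this
  exact ⟨b', hb', by simp [hp]⟩

lemma lineRestrict_skewDeriv_of_mem_Bsub (h1 : a 1 = c * A) (h2 : a 2 = c ^ 2 * A) {b : R2}
    (hb : b ∈ Bsub a) : lineRestrict c (skewDeriv c A b) = 0 := by
  induction hb using Algebra.adjoin_induction with
  | mem x hx =>
    rcases hx with rfl | rfl <;> rw [skewDeriv_Q2] <;>
      simp [lineRestrict, h1, h2]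
    ring
  | algebraMap r => simp
  | add x y _ _ hx hy => simp [hx, hy]
  | mul x y _ _ hx hy => simp [Derivation.leibniz, hx, hy]

/-- Reflexivity of a free module: the pair `w = (c y - z)^2`, `h` is coprime in `ℂ[Q_1,Q_2]` when
`h` does not vanish on `c y = z`, so `w x, h x ∈ Λ_a` forces `x ∈ Λ_a`. -/
lemma mem_LamMod_of_mul_mem (h1 : a 1 = c * A) (h2 : a 2 = c ^ 2 * A) (hc : c ≠ 0)
    (hA0 : A ≠ 0) (hA2 : 1 + A ≠ 0) (hfree : Module.Free ↥(Bsub a) ↥(LamMod a)) {h x : R2}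
    (hh : h ∈ Bsub a) (hne : lineRestrict c h ≠ 0) (hwx : antiForm c ^ 2 * x ∈ LamMod a)
    (hhx : h * x ∈ LamMod a) : x ∈ LamMod a := by
  let w : Bsub a := ⟨antiForm c ^ 2, antiForm_sq_mem_Bsub h1 h2 hA0⟩
  let h' : Bsub a := ⟨h, hh⟩
  let m : LamMod a := ⟨antiForm c ^ 2 * x, hwx⟩
  let n : LamMod a := ⟨h * x, hhx⟩
  have hmn : h' • m = w • n := by
    apply Subtype.ext
    change h * (antiForm c ^ 2 * x) = antiForm c ^ 2 * (h * x)
    ring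
  let bs := Module.Free.chooseBasis (Bsub a) (LamMod a)
  have hdiv (j) : ∃ k : Bsub a, bs.repr m j = w * k := by
    have hj : h' * bs.repr m j = w * bs.repr n j := by
      simpa using DFunLike.congr_fun (congrArg bs.repr hmn) j
    have hj' := congrArg (fun b : Bsub a => lineRestrict c b) hj
    have h0 : lineRestrict c (bs.repr m j : R2) = 0 := by
      simpa [h', w, lineRestrict_antiForm, hne] using hj'
    obtain ⟨k, hk, e⟩ := exists_eq_antiForm_sq_mul h1 h2 hc hA0 hA2 (bs.repr m j).2 h0
    exact ⟨⟨k, hk⟩, Subtype.ext e⟩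
  choose k hk using hdiv
  let m' : LamMod a := ∑ j ∈ (bs.repr m).support, k j • bs j
  have hm : m = w • m' := by
    conv_lhs => rw [← bs.linearCombination_repr m, Finsupp.linearCombination_apply, Finsupp.sum]
    simp only [m', Finset.smul_sum, hk, mul_smul]
  have hw0 : antiForm c ^ 2 ≠ 0 := by
    refine pow_ne_zero _ fun h => ?_
    have := congrArg (skewDeriv c A) h
    rw [skewDeriv_antiForm, map_zero, C_eq_zero] at this
    exact mul_ne_zero hc hA2 this
  have e : antiForm c ^ 2 * x = antiForm c ^ 2 * (m' : R2) := congrArg Subtype.val hm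
  rw [mul_left_cancel₀ hw0 e]
  exact m'.2

end Structure

/-- If `a` is a sequence of nonzero numbers with `a_i = c^i a` for `i = 1,2,3`, where
`c ≠ 0` and `a ≠ ±1`, and if `Λ_a` is Cohen–Macaulay (equivalently, a free module over
`ℂ[Q_1,Q_2]`), then `a_i = c^i a` for all `i ≥ 1`. -/
theorem lambda_CM_implies_const (a : ℕ → ℂ) (ha : ∀ i : ℕ, 1 ≤ i → a i ≠ 0) (c A : ℂ)
    (hc : c ≠ 0) (hA1 : A ≠ 1) (hA2 : A ≠ -1)
    (h123 : ∀ i : ℕ, 1 ≤ i → i ≤ 3 → a i = c ^ i * A)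
    (hfree : Module.Free ↥(Bsub a) ↥(LamMod a)) :
    ∀ i : ℕ, 1 ≤ i → a i = c ^ i * A := by
  have h1 : a 1 = c * A := by simpa using h123 1 le_rfl (by norm_num)
  have h2 := h123 2 (by norm_num) (by norm_num)
  have h3 := h123 3 (by norm_num) le_rfl
  have hA0 : A ≠ 0 := fun h => ha 1 le_rfl (by simp [h1, h])
  have hA : 1 + A ≠ 0 := fun h => hA2 (by linear_combination h)
  intro i hi
  obtain ⟨g, hg, h, hh, e⟩ := exists_eq_add_mul_antiForm h1 h2 hc hA0 hA (Q2 a i)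
  have h0 : lineRestrict c h = 0 := by
    by_contra hne
    refine antiForm_notMem_LamMod h1 hc hA
      (mem_LamMod_of_mul_mem h1 h2 hc hA0 hA hfree hh hne ?_ ?_)
    · rw [← pow_succ]
      exact Submodule.subset_span (antiForm_cube_mem_Lam h1 h2 h3 hA0 hA1 hA)
    · refine Submodule.subset_span ?_
      rw [← sub_eq_of_eq_add' e]
      exact sub_mem (Q2_mem_Lam a hi) (Bsub_le_Lam a hg)
  have hD := congrArg (fun x => lineRestrict c (skewDeriv c A x)) e
  have hi0 : (i : ℂ) ≠ 0 := by exact_mod_cast (by omega : i ≠ 0)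
  simp only [skewDeriv_Q2, map_add, Derivation.leibniz, smul_eq_mul, map_mul,
    lineRestrict_skewDeriv_of_mem_Bsub h1 h2 hg, h0, lineRestrict_antiForm] at hD
  have hev := congrArg (Polynomial.eval 1) hD
  simp [lineRestrict] at hev
  obtain ⟨k, rfl⟩ : ∃ k, i = k + 1 := ⟨i - 1, by omega⟩
  simp only [Nat.add_sub_cancel] at hev
  refine mul_left_cancel₀ hi0 ?_
  linear_combination hev
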